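/- arXiv:1107.5523 — 3 statements merged into one kernel-verified Lean document; each statement's English description precedes it below -/
import Mathlib

section
/- Let F be a field and let m = Σ_{U ⊆ {1,…,s}} a_U · ∏_{u∈U} y_u ∈ F[y_1,…,y_s] be a multilinear polynomial with a_{{1,…,s}} ≠ 0. The following are equivalent: (1) m decomposes into linear factors as m = a_{{1,…,s}} · ∏_{u=1}^{s} (y_u + μ_u), where μ_u = a_{{1,…,s}∖{u}} / a_{{1,…,s}}; (2) a_U · a_V = a_{U∩V} · a_{{1,…,s}} for all subsets U, V ⊆ {1,…,s} such that |V| = s−1 and min({1,…,s}∖V) < min({1,…,s}∖U), with the convention that min ∅ is larger than the minimum of any nonempty set. -/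
open MvPolynomial

theorem coeff_sum_C_mul_prod_X {σ R : Type*} [Fintype σ] [DecidableEq σ] [CommSemiring R]
    (a : Finset σ → R) (T : Finset σ) :
    (∑ U ∈ Finset.univ.powerset, C (a U) * ∏ u ∈ U, (X u : MvPolynomial σ R)).coeff
      (∑ u ∈ T, Finsupp.single u 1) = a T := by
  have support_eq (U : Finset σ) : (∑ u ∈ U, Finsupp.single u 1 : σ →₀ ℕ).support = U := by
    ext x
    simp [Finsupp.finsetSum_apply, Finsupp.single_apply]
  have prod_X (U : Finset σ) : ∏ u ∈ U, (X u : MvPolynomial σ R) =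
      monomial (∑ u ∈ U, Finsupp.single u 1) 1 := by
    rw [monomial_sum_one]
    rfl
  rw [coeff_sum, Finset.sum_eq_single T]
  · simp [prod_X]
  · intro U _ hUT
    rw [prod_X, coeff_C_mul, coeff_monomial, if_neg, mul_zero]
    intro h
    exact hUT (by rw [← support_eq U, h, support_eq T])
  · simp

theorem sum_C_mul_prod_X_inj {σ R : Type*} [Fintype σ] [DecidableEq σ] [CommSemiring R]
    {a b : Finset σ → R} :
    (∑ U ∈ Finset.univ.powerset, C (a U) * ∏ u ∈ U, (X u : MvPolynomial σ R)) =
      ∑ U ∈ Finset.univ.powerset, C (b U) * ∏ u ∈ U, (X u : MvPolynomial σ R) ↔ a = b := by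
  refine ⟨fun h => funext fun T => ?_, fun h => by rw [h]⟩
  rw [← coeff_sum_C_mul_prod_X a T, h, coeff_sum_C_mul_prod_X]

theorem C_mul_prod_X_add_C {σ R : Type*} [Fintype σ] [DecidableEq σ] [CommSemiring R]
    (c : R) (μ : σ → R) :
    C c * ∏ u : σ, (X u + C (μ u)) =
      ∑ U ∈ Finset.univ.powerset,
        C (c * ∏ u ∈ Finset.univ \ U, μ u) * ∏ u ∈ U, (X u : MvPolynomial σ R) := by
  rw [Finset.prod_add, Finset.mul_sum]
  refine Finset.sum_congr rfl fun U _ => ?_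
  rw [C_mul, map_prod]
  ring

/-- a multilinear polynomial `m = Σ_U a_U y_U` with `a_{{1,…,s}} ≠ 0`
factors into the linear factors `a_{{1,…,s}} ∏_u (y_u + a_{{1,…,s}∖{u}}/a_{{1,…,s}})`
iff `a_U a_V = a_{U∩V} a_{{1,…,s}}` whenever `|V| = s-1` and
`min({1,…,s}∖V) < min({1,…,s}∖U)` (with `min ∅` larger than any minimum). -/
theorem multilinear_factorization
    {F : Type*} [Field F] {s : ℕ} (hs : 1 ≤ s)
    (a : Finset (Fin s) → F) (ha : a Finset.univ ≠ 0) :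
    ((∑ U ∈ Finset.univ.powerset,
        MvPolynomial.C (a U) * ∏ u ∈ U, (MvPolynomial.X u : MvPolynomial (Fin s) F))
      = MvPolynomial.C (a Finset.univ) *
        ∏ u : Fin s,
          (MvPolynomial.X u + MvPolynomial.C (a (Finset.univ \ {u}) / a Finset.univ)))
    ↔ (∀ U V : Finset (Fin s), V.card = s - 1 →
        (Finset.univ \ V).min < (Finset.univ \ U).min →
        a U * a V = a (U ∩ V) * a Finset.univ) := by
  rw [C_mul_prod_X_add_C, sum_C_mul_prod_X_inj]
  constructor
  · intro h U V hV hlt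
    obtain ⟨v, hv⟩ : ∃ v, Finset.univ \ V = {v} := by
      rw [← Finset.card_eq_one, ← Finset.compl_eq_univ_sdiff, Finset.card_compl,
        Fintype.card_fin, hV]
      omega
    obtain rfl : V = Finset.univ \ {v} := by
      rw [← hv, Finset.sdiff_sdiff_eq_self (Finset.subset_univ V)]
    rw [hv, Finset.min_singleton] at hlt
    have hvU : v ∉ Finset.univ \ U := fun hmem => absurd (Finset.min_le hmem) hlt.not_ge
    have hUV : Finset.univ \ (U ∩ (Finset.univ \ {v})) = insert v (Finset.univ \ U) := by
      ext x
      simp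
      tauto
    have hU := congrFun h U
    have hI := congrFun h (U ∩ (Finset.univ \ {v}))
    simp only [hUV, Finset.prod_insert hvU] at hU hI
    rw [hU, hI]
    field_simp
  · intro h
    suffices key : ∀ T : Finset (Fin s), a (Finset.univ \ T) =
        a Finset.univ * ∏ u ∈ T, a (Finset.univ \ {u}) / a Finset.univ by
      funext U
      rw [← key, Finset.sdiff_sdiff_eq_self (Finset.subset_univ U)]
    intro T
    induction T using Finset.induction_on_min with
    | empty => simp
    | insert v T hv ih =>
      have hcompl (S : Finset (Fin s)) : Finset.univ \ (Finset.univ \ S) = S :=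
        Finset.sdiff_sdiff_eq_self (Finset.subset_univ S)
      have hvT : v ∉ T := fun hmem => lt_irrefl v (hv v hmem)
      have hrel := h (Finset.univ \ T) (Finset.univ \ {v})
        (by rw [← Finset.compl_eq_univ_sdiff, Finset.card_compl]; simp)
        (by
          rw [hcompl, hcompl, Finset.min_singleton]
          rcases hT : T.min with _ | w
          · exact WithTop.coe_lt_top v
          · exact WithTop.coe_lt_coe.2 (hv w (Finset.mem_of_min hT)))
      have hinter : (Finset.univ \ T) ∩ (Finset.univ \ {v}) = Finset.univ \ insert v T := by
        ext x
        simp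
        tauto
      rw [hinter, ih] at hrel
      rw [Finset.prod_insert hvT]
      apply mul_right_cancel₀ ha
      rw [← hrel]
      field_simp
end

section
/- Let R be a commutative ring and M a matrix over R with rows and columns indexed by {1,…,k}. For index tuples J = (j_1,…,j_k) and L = (l_1,…,l_k) in {1,…,k}^k and 1 ≤ s < k, write J_s = (j_1,…,j_s), L_s = (l_1,…,l_s). Then the minors of M satisfy [J_s;L_s]·[J;L] = Σ_{t=s+1}^{k} (−1)^{t+s+1} [J_s∪(j_t); L_s∪(l_{s+1})]·[J∖(j_t); L∖(l_{s+1})], where ∪ denotes concatenation of tuples and J∖(j_t) denotes removal of the entry j_t from J (the determinant of a submatrix with a repeated row or column being zero). -/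
open Matrix

/-- Expanding a determinant along column `p`, with that column replaced by column `q`, yields
`det A` if `q = p` and zero otherwise. -/
theorem Matrix.sum_mul_det_submatrix_succAbove {R : Type*} [CommRing R] {n : ℕ}
    (A : Matrix (Fin (n + 1)) (Fin (n + 1)) R) (p q : Fin (n + 1)) :
    ∑ t : Fin (n + 1), (-1 : R) ^ ((t : ℕ) + (p : ℕ)) * A t q *
      (A.submatrix t.succAbove p.succAbove).det = if q = p then A.det else 0 := by
  have h : (A.updateCol p (fun t => A t q)).det = if q = p then A.det else 0 := by
    split_ifs with hq
    · subst hq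
      exact congrArg det (A.updateCol_eq_self q)
    · refine det_zero_of_column_eq hq fun t => ?_
      simp [updateCol_ne hq]
  rw [← h, det_succ_column _ p]
  simp [submatrix_updateCol_succAbove]

/-- Bordering the minor on rows `r` and columns `c` by row `t` and column `p`, and summing over
`t` against the cofactors of column `p`. -/
theorem Matrix.sum_det_submatrix_snoc_mul {R : Type*} [CommRing R] {n s : ℕ}
    (A : Matrix (Fin (n + 1)) (Fin (n + 1)) R) (r c : Fin s → Fin (n + 1)) (p : Fin (n + 1))
    (hc : ∀ b, c b ≠ p) :
    ∑ t : Fin (n + 1), (-1 : R) ^ ((t : ℕ) + (p : ℕ)) *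
      ((A.submatrix (Fin.snoc r t : Fin (s + 1) → Fin (n + 1))
          (Fin.snoc c p : Fin (s + 1) → Fin (n + 1))).det *
        (A.submatrix t.succAbove p.succAbove).det) = (A.submatrix r c).det * A.det := by
  set d : Fin (s + 1) → Fin (n + 1) := Fin.snoc c p with hd
  have key (t : Fin (n + 1)) :
      (A.submatrix (Fin.snoc r t : Fin (s + 1) → Fin (n + 1)) d).det =
        ∑ b : Fin (s + 1), (-1 : R) ^ (s + (b : ℕ)) * A t (d b) *
          (A.submatrix r (d ∘ b.succAbove)).det := by
    rw [det_succ_row _ (Fin.last s)]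
    refine Finset.sum_congr rfl fun b _ => ?_
    congr 2
    · simp
    · ext i j
      simp
  calc
    _ = ∑ b : Fin (s + 1), (-1 : R) ^ (s + (b : ℕ)) * (A.submatrix r (d ∘ b.succAbove)).det *
          ∑ t : Fin (n + 1), (-1 : R) ^ ((t : ℕ) + (p : ℕ)) * A t (d b) *
            (A.submatrix t.succAbove p.succAbove).det := by
      simp_rw [key, Finset.mul_sum, Finset.sum_mul, Finset.mul_sum]
      rw [Finset.sum_comm]
      refine Finset.sum_congr rfl fun b _ => Finset.sum_congr rfl fun t _ => ?_
      ring
    _ = _ := by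
      simp_rw [sum_mul_det_submatrix_succAbove]
      have hlast : d ∘ (Fin.last s).succAbove = c := by
        ext j
        simp [hd]
      rw [Fin.sum_univ_castSucc, hlast]
      simp [hd, hc, ← two_mul]


/-- the minor identity (Lemma on minors).  Indices are `0`-based: the matrix
has rows and columns indexed by `Fin (n+1)` (so `k = n+1`), `J L : Fin (n+1) → Fin (n+1)`
are tuples, `J_s, L_s` their first `s` entries, the entry `l_{s+1}` (1-based) is `L ⟨s, _⟩`,
the sum runs over positions `t` with `s ≤ t`, the sign `(-1)^{t+s+1}` (1-based `t`) becomes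
`(-1)^{t+s}` (0-based `t`), concatenation is `Fin.snoc` and removal of the entry in
position `t` is composition with `Fin.succAbove t`. -/
theorem minor_identity {R : Type*} [CommRing R] {n : ℕ}
    (M : Matrix (Fin (n + 1)) (Fin (n + 1)) R)
    (J L : Fin (n + 1) → Fin (n + 1)) (s : ℕ) (hs1 : 1 ≤ s) (hs : s < n + 1) :
    (M.submatrix (fun a : Fin s => J (Fin.castLE hs.le a))
        (fun a : Fin s => L (Fin.castLE hs.le a))).det * (M.submatrix J L).det
      = ∑ t ∈ Finset.univ.filter (fun t : Fin (n + 1) => s ≤ (t : ℕ)),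
          (-1 : R) ^ ((t : ℕ) + s) *
            ((M.submatrix (Fin.snoc (fun a : Fin s => J (Fin.castLE hs.le a)) (J t))
                (Fin.snoc (fun a : Fin s => L (Fin.castLE hs.le a)) (L ⟨s, hs⟩))).det *
             (M.submatrix (fun a => J (Fin.succAbove t a))
                (fun a => L (Fin.succAbove ⟨s, hs⟩ a))).det) := by
  have h := (M.submatrix J L).sum_det_submatrix_snoc_mul (Fin.castLE hs.le) (Fin.castLE hs.le)
    ⟨s, hs⟩ fun b => Fin.ne_of_lt b.isLt
  simp only [submatrix_submatrix, Fin.comp_snoc] at h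
  refine h.symm.trans (Finset.sum_filter_of_ne fun t _ ht => ?_).symm
  by_contra! hts
  refine ht ?_
  rw [det_zero_of_row_eq (i := Fin.castSucc ⟨t, hts⟩) (j := Fin.last s)
    (Fin.castSucc_lt_last _).ne]
  · simp
  · ext b
    simp only [submatrix_apply, Fin.snoc_castSucc, Fin.snoc_last]
    rfl
end

section
/- Let F be a field and M ∈ F^{k×k} a matrix that is not diagonal. Then there exist nonempty tuples J, L ⊆ (1,…,k) with J ∩ L = ∅ such that [J;L]_M ≠ 0 and [J∪(j); L∪(l)]_M = 0 for all j, l ∈ (1,…,k) ∖ (J ∪ L) with j ≠ l. (This is the correctness statement for the modified Gaussian elimination algorithm used to find a maximal nonvanishing off-diagonal minor.) -/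
open Matrix

/-- for a non-diagonal matrix `M ∈ F^{k×k}` there exist nonempty disjoint
index tuples `J, L ⊆ (1,…,k)` with `[J;L]_M ≠ 0` and `[J∪(j);L∪(l)]_M = 0` for all
`j ≠ l` outside `J ∪ L` (correctness of the modified Gaussian elimination). -/
theorem maximal_offdiagonal_minor_exists
    {F : Type*} [Field F] {k : ℕ}
    (M : Matrix (Fin k) (Fin k) F) (hM : ¬ M.IsDiag) :
    ∃ (t : ℕ) (_ : 0 < t) (J L : Fin t → Fin k),
      Function.Injective J ∧ Function.Injective L ∧
      (∀ a b, J a ≠ L b) ∧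
      (M.submatrix J L).det ≠ 0 ∧
      ∀ j l : Fin k,
        (∀ a, J a ≠ j ∧ L a ≠ j) → (∀ a, J a ≠ l ∧ L a ≠ l) → j ≠ l →
        (M.submatrix (Fin.snoc J j) (Fin.snoc L l)).det = 0 := by
  classical
  let P : ℕ → Prop := fun t => ∃ J L : Fin t → Fin k,
    Function.Injective J ∧ Function.Injective L ∧ (∀ a b, J a ≠ L b) ∧
      (M.submatrix J L).det ≠ 0
  have le_of_P : ∀ t, P t → t ≤ k := by
    rintro t ⟨J, L, hJ, -⟩
    simpa using Fintype.card_le_of_injective J hJ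
  have h_one : P 1 := by
    simp only [Matrix.IsDiag, Pairwise, not_forall] at hM
    obtain ⟨i, j, hij, h⟩ := hM
    exact ⟨fun _ => i, fun _ => j, Function.injective_of_subsingleton _,
      Function.injective_of_subsingleton _, fun _ _ => hij, by simpa using h⟩
  have h_pos : 1 ≤ Nat.findGreatest P k := Nat.le_findGreatest (le_of_P 1 h_one) h_one
  obtain ⟨J, L, hJ, hL, hJL, hdet⟩ : P (Nat.findGreatest P k) :=
    Nat.findGreatest_spec (le_of_P 1 h_one) h_one
  refine ⟨_, h_pos, J, L, hJ, hL, hJL, hdet, fun j l hj hl hjl => ?_⟩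
  by_contra h
  have h_succ : P (Nat.findGreatest P k + 1) := by
    refine ⟨Fin.snoc J j, Fin.snoc L l, ?_, ?_, ?_, h⟩
    · exact Fin.snoc_injective_iff.2 ⟨hJ, fun ⟨a, ha⟩ => (hj a).1 ha⟩
    · exact Fin.snoc_injective_iff.2 ⟨hL, fun ⟨a, ha⟩ => (hl a).2 ha⟩
    · intro a b
      induction a using Fin.lastCases <;> induction b using Fin.lastCases <;>
        simp only [Fin.snoc_last, Fin.snoc_castSucc]
      exacts [hjl, (hj _).2.symm, (hl _).1, hJL _ _]
  exact (Nat.le_findGreatest (le_of_P _ h_succ) h_succ).not_gt (Nat.lt_succ_self _)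
end
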